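/- Let m ≥ 1 be an integer, λ ∈ ℝ, and t₀ > 0. Let A : ℝ → M_m(ℝ) be a matrix-valued function whose entries are real analytic on the interval (−t₀, t₀), with A(0) = λ·I_m, and let λ₁, …, λ_m : ℝ → ℝ be real analytic on (−t₀, t₀) with λ_j(0) = λ for all j. Assume that for all t ∈ (−t₀, t₀) and all τ ∈ ℝ one has det(τ·I_m − A(t)) = ∏_{j=1}^{m} (τ − λ_j(t)). Then for every χ ∈ ℝ one has det(χ·I_m − A′(0)) = ∏_{j=1}^{m} (χ − λ_j′(0)), where A′(0) is the entrywise derivative of A at 0. In particular, the multiset of first derivatives {λ_j′(0) : j = 1, …, m} coincides with the multiset of eigenvalues of the real matrix A′(0). -/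

import Mathlib

/-- Let `m ≥ 1`, `λ ∈ ℝ`, `t₀ > 0`.  Let `A : ℝ → M_m(ℝ)` have real
analytic entries on `(-t₀, t₀)` with `A 0 = λ·I`, and let `λ₁, …, λ_m : ℝ → ℝ` be real
analytic on `(-t₀, t₀)` with `λ_j(0) = λ`.  If
`det (τ·I - A t) = ∏_j (τ - λ_j t)` for all `t ∈ (-t₀, t₀)` and all `τ ∈ ℝ`, then
`det (χ·I - A′(0)) = ∏_j (χ - λ_j′(0))` for every `χ ∈ ℝ`, where `A′(0)` is the
entrywise derivative of `A` at `0`; in particular the multiset of first derivatives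
`{λ_j′(0)}` is the multiset of eigenvalues of `A′(0)`. -/
theorem derivative_eigenvalue_branches_char_poly
    (m : ℕ) (hm : 1 ≤ m) (lam : ℝ) (t₀ : ℝ) (ht₀ : 0 < t₀)
    (A : ℝ → Matrix (Fin m) (Fin m) ℝ)
    (hA : ∀ i j : Fin m, ∀ t ∈ Set.Ioo (-t₀) t₀, AnalyticAt ℝ (fun s => A s i j) t)
    (hA0 : A 0 = lam • (1 : Matrix (Fin m) (Fin m) ℝ))
    (l : Fin m → ℝ → ℝ)
    (hl : ∀ j, ∀ t ∈ Set.Ioo (-t₀) t₀, AnalyticAt ℝ (l j) t)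
    (hl0 : ∀ j, l j 0 = lam)
    (hchar : ∀ t ∈ Set.Ioo (-t₀) t₀, ∀ τ : ℝ,
      (τ • (1 : Matrix (Fin m) (Fin m) ℝ) - A t).det = ∏ j, (τ - l j t)) :
    ∀ χ : ℝ,
      (χ • (1 : Matrix (Fin m) (Fin m) ℝ) -
          Matrix.of fun i j => deriv (fun s => A s i j) 0).det
        = ∏ j, (χ - deriv (l j) 0) := by
  intro χ
  have h0 : (0 : ℝ) ∈ Set.Ioo (-t₀) t₀ := ⟨by linarith, ht₀⟩
  have slope_tendsto {f : ℝ → ℝ} (hf : AnalyticAt ℝ f 0) :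
      Filter.Tendsto (slope f 0) (nhdsWithin 0 {0}ᶜ) (nhds (deriv f 0)) :=
    hasDerivAt_iff_tendsto_slope.mp hf.differentiableAt.hasDerivAt
  have tendsto_det : Filter.Tendsto
      (fun t => (χ • (1 : Matrix (Fin m) (Fin m) ℝ) -
        Matrix.of fun i j => slope (fun s => A s i j) 0 t).det) (nhdsWithin 0 {0}ᶜ)
      (nhds (χ • (1 : Matrix (Fin m) (Fin m) ℝ) -
        Matrix.of fun i j => deriv (fun s => A s i j) 0).det) := by
    refine ((continuous_id.matrix_det).tendsto _).comp (tendsto_const_nhds.sub ?_)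
    exact tendsto_pi_nhds.mpr fun i => tendsto_pi_nhds.mpr fun j => slope_tendsto (hA i j 0 h0)
  have tendsto_prod : Filter.Tendsto (fun t => ∏ j, (χ - slope (l j) 0 t))
      (nhdsWithin 0 {0}ᶜ) (nhds (∏ j, (χ - deriv (l j) 0))) :=
    tendsto_finsetProd _ fun j _ => tendsto_const_nhds.sub (slope_tendsto (hl j 0 h0))
  refine tendsto_nhds_unique (tendsto_det.congr' ?_) tendsto_prod
  filter_upwards [self_mem_nhdsWithin,
    mem_nhdsWithin_of_mem_nhds (Ioo_mem_nhds h0.1 h0.2)] with t ht htI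
  have ht' : t ≠ 0 := ht
  have det_scaled : χ • (1 : Matrix (Fin m) (Fin m) ℝ) -
      Matrix.of (fun i j => slope (fun s => A s i j) 0 t) =
      t⁻¹ • ((lam + χ * t) • (1 : Matrix (Fin m) (Fin m) ℝ) - A t) := by
    ext i j
    simp only [slope_def_field, hA0, Matrix.sub_apply, Matrix.smul_apply, Matrix.of_apply,
      smul_eq_mul]
    field_simp
    ring
  have prod_scaled (j : Fin m) : χ - slope (l j) 0 t = t⁻¹ * (lam + χ * t - l j t) := by
    simp only [slope_def_field, hl0]
    field_simp
    ring
  rw [det_scaled, Matrix.det_smul, hchar t htI]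
  simp [prod_scaled, Finset.prod_mul_distrib]
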